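/- arXiv:1104.2072 — 2 statements merged into one kernel-verified Lean document; each statement's English description precedes it below -/
import Mathlib

section
/- Let k be a solid assignment and assume the constants (λ_z)_{z∈X∪Y} are generic. Fix B ∈ 𝔹_k and set I := B∩X, J := B∩Y, X_B := X ∪ Y_{m(I)}, and Q_B := q_{X_B∖B}. Then for every B′ ∈ 𝔹_k, writing I′ := B′∩X, one has Q_B(b(B′)) ≠ 0 if and only if the following four conditions all hold: (i) I′ ⊆ I, (ii) B′ ∩ Y_{m(I)} = J, (iii) k(I′) = k(I), and (iv) (B′∩Y)∖B = Y_{m(I′)}∖Y_{m(I)}. -/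
open MvPolynomial

noncomputable section

/-- The linear polynomial `p_x : t ↦ x ⬝ t`. -/
def pLin (n : ℕ) (x : Fin n → ℝ) : MvPolynomial (Fin n) ℝ :=
  ∑ i, MvPolynomial.C (x i) * MvPolynomial.X i

/-- `p_Z = ∏_{x ∈ Z} p_x` for a sub-multiset `Z` of the multiset indexed by `ι`. -/
def pProd (n : ℕ) {ι : Type} (v : ι → Fin n → ℝ) (Z : Finset ι) : MvPolynomial (Fin n) ℝ :=
  ∏ a ∈ Z, pLin n (v a)

/-- `q_Z = ∏_{x ∈ Z} (p_x - λ_x)`. -/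
def qProd (n : ℕ) {ι : Type} (v : ι → Fin n → ℝ) (lam : ι → ℝ) (Z : Finset ι) :
    MvPolynomial (Fin n) ℝ :=
  ∏ a ∈ Z, (pLin n (v a) - MvPolynomial.C (lam a))

/-- The pairing `⟨p,q⟩ = (p(∂)q)(0) = ∑_α α! p_α q_α`. -/
def pairing (n : ℕ) (p q : MvPolynomial (Fin n) ℝ) : ℝ :=
  ∑ α ∈ p.support, p.coeff α * q.coeff α * (α.prod fun _ e => (Nat.factorial e : ℝ))

/-- `B` is a basis of the multiset: its vectors form a basis of `ℝ^n`. -/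
def IsBasisSet (n : ℕ) {ι : Type} (v : ι → Fin n → ℝ) (B : Finset ι) : Prop :=
  LinearIndependent ℝ (fun b : B => v b) ∧ Submodule.span ℝ (v '' ↑B) = ⊤

/-- The ideal `𝒥_{𝔹'}` generated by the `p_Z` over all `Z` meeting every `B ∈ 𝔹'`. -/
def Jideal (n : ℕ) {ι : Type} [DecidableEq ι] (v : ι → Fin n → ℝ) (𝔹' : Set (Finset ι)) :
    Ideal (MvPolynomial (Fin n) ℝ) :=
  Ideal.span {p | ∃ Z : Finset ι, (∀ B ∈ 𝔹', (Z ∩ B).Nonempty) ∧ p = pProd n v Z}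

/-- The kernel space `𝒟_{𝔹'}`. -/
def Dspace (n : ℕ) {ι : Type} [DecidableEq ι] (v : ι → Fin n → ℝ) (𝔹' : Set (Finset ι)) :
    Submodule ℝ (MvPolynomial (Fin n) ℝ) where
  carrier := {f | ∀ g ∈ Jideal n v 𝔹', pairing n g f = 0}
  zero_mem' := by intro g _; simp [pairing]
  add_mem' := by
    intro a b ha hb g hg
    have h : pairing n g (a + b) = pairing n g a + pairing n g b := by
      simp only [pairing, MvPolynomial.coeff_add]
      rw [← Finset.sum_add_distrib]
      exact Finset.sum_congr rfl fun α _ => by ring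
    rw [h, ha g hg, hb g hg, add_zero]
  smul_mem' := by
    intro c f hf g hg
    have h : pairing n g (c • f) = c * pairing n g f := by
      simp only [pairing, MvPolynomial.coeff_smul, smul_eq_mul, Finset.mul_sum]
      exact Finset.sum_congr rfl fun α _ => by ring
    rw [h, hf g hg, mul_zero]

/-- A solid assignment `k : 2^X → ℕ`. -/
def Solid (n : ℕ) {ι : Type} (v : ι → Fin n → ℝ) (k : Finset ι → ℕ) : Prop :=
  ∀ Z Z' : Finset ι,
    Submodule.span ℝ (v '' ↑Z) ≤ Submodule.span ℝ (v '' ↑Z') → k Z ≤ k Z'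

/-- An incremental assignment. -/
def Incremental {ι : Type} [DecidableEq ι] (k : Finset ι → ℕ) : Prop :=
  ∀ (Z : Finset ι) (x : ι), k (insert x Z) ≤ k Z + 1

/-- `m(I) = k(I) + n - #I`. -/
def mVal (n : ℕ) {ι : Type} (k : Finset ι → ℕ) (I : Finset ι) : ℕ := k I + n - I.card

/-- `B ∩ X` for `B ⊆ X ∪ Y`. -/
def leftPart {ι : Type} [Fintype ι] [DecidableEq ι] {M : ℕ} (B : Finset (ι ⊕ Fin M)) :
    Finset ι :=
  Finset.univ.filter fun i => Sum.inl i ∈ B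

/-- `B ∩ Y` for `B ⊆ X ∪ Y`, as a set of indices in `Y`. -/
def rightPart {ι : Type} [Fintype ι] [DecidableEq ι] {M : ℕ} (B : Finset (ι ⊕ Fin M)) :
    Finset (Fin M) :=
  Finset.univ.filter fun j => Sum.inr j ∈ B

/-- `Y_i = {y_1, …, y_i}` as a set of indices. -/
def YFin {M : ℕ} (i : ℕ) : Finset (Fin M) := Finset.univ.filter fun j => (j : ℕ) < i

/-- `X ∪ Y_i` as a subset of the index set of `X ∪ Y`. -/
def XYup (ι : Type) [Fintype ι] [DecidableEq ι] (M : ℕ) (i : ℕ) : Finset (ι ⊕ Fin M) :=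
  Finset.univ.image Sum.inl ∪ (YFin (M := M) i).image Sum.inr

/-- `Y` is in general position in `X ∪ Y`: no `y ∈ Y` lies in the span of fewer than `n`
vectors of `(X ∪ Y) ∖ {y}`. -/
def GeneralPosition (n : ℕ) {ι : Type} [Fintype ι] [DecidableEq ι] {M : ℕ}
    (v : ι → Fin n → ℝ) (y : Fin M → Fin n → ℝ) : Prop :=
  ∀ (j : Fin M) (S : Finset (ι ⊕ Fin M)), Sum.inr j ∉ S → S.card < n →
    y j ∉ Submodule.span ℝ (Sum.elim v y '' ↑S)

/-- `𝔹_k : the bases `B` of `X ∪ Y` with `B ∩ Y ⊆ Y_{m(B ∩ X)}`. -/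
def Bk (n : ℕ) {ι : Type} [Fintype ι] [DecidableEq ι] (v : ι → Fin n → ℝ) {M : ℕ}
    (y : Fin M → Fin n → ℝ) (k : Finset ι → ℕ) : Set (Finset (ι ⊕ Fin M)) :=
  {B | IsBasisSet n (Sum.elim v y) B ∧
    ∀ j : Fin M, Sum.inr j ∈ B → (j : ℕ) < mVal n k (leftPart B)}

/-- The space `𝒫_k = ∑_{Z ⊆ X} p_{X∖Z} Π_{k(Z)}`. -/
def Pspace (n : ℕ) {ι : Type} [Fintype ι] [DecidableEq ι] (v : ι → Fin n → ℝ)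
    (k : Finset ι → ℕ) : Submodule ℝ (MvPolynomial (Fin n) ℝ) :=
  ⨆ Z : Finset ι,
    Submodule.map (LinearMap.mulLeft ℝ (pProd n v (Finset.univ \ Z)))
      (MvPolynomial.restrictTotalDegree (Fin n) ℝ (k Z))

/-- The constants `λ` are generic: each basis `B` determines a point `bp B` at which
`q_z` vanishes exactly when `z ∈ B`. -/
def Generic (n : ℕ) {ι : Type} (v : ι → Fin n → ℝ) (lam : ι → ℝ)
    (bp : Finset ι → Fin n → ℝ) : Prop :=
  ∀ B : Finset ι, IsBasisSet n v B →
    ∀ z : ι, MvPolynomial.eval (bp B) (pLin n (v z) - MvPolynomial.C (lam z)) = 0 ↔ z ∈ B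

/-- `x` is placable in `𝔹'`. -/
def Placable {ι : Type} [DecidableEq ι] (x : ι) (𝔹' : Set (Finset ι)) : Prop :=
  ∀ B ∈ 𝔹', ∃ a ∈ B, (insert x B).erase a ∈ 𝔹'

/-- `𝔹'` is placible. -/
inductive Placible {ι : Type} [DecidableEq ι] : Set (Finset ι) → Prop
  | singleton (B : Finset ι) : Placible {B}
  | split (𝔹' : Set (Finset ι)) (x : ι) (hx : Placable x 𝔹')
      (hne1 : {B ∈ 𝔹' | x ∈ B}.Nonempty) (hne2 : {B ∈ 𝔹' | x ∉ B}.Nonempty)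
      (hp1 : Placible {B ∈ 𝔹' | x ∈ B}) (hp2 : Placible {B ∈ 𝔹' | x ∉ B}) :
      Placible 𝔹'

/-- `X(I)` : the elements of `X ∖ I` not in the span of the earlier elements of `I`. -/
def XsetI (n : ℕ) {ι : Type} [Fintype ι] [DecidableEq ι] [LinearOrder ι]
    (v : ι → Fin n → ℝ) (I : Finset ι) : Finset ι := by
  classical
  exact Finset.univ.filter fun x =>
    x ∉ I ∧ v x ∉ Submodule.span ℝ (v '' {b | b ∈ I ∧ b < x})

/-- `X'(B)` for `B ⊆ X ∪ Y`, with the order on `X ∪ Y` putting `X` (with its own order)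
before `Y` (ordered as given). -/
def XprimeB (n : ℕ) {ι : Type} [Fintype ι] [DecidableEq ι] [LinearOrder ι] {M : ℕ}
    (v : ι → Fin n → ℝ) (y : Fin M → Fin n → ℝ) (B : Finset (ι ⊕ Fin M)) :
    Finset (ι ⊕ Fin M) := by
  classical
  exact Finset.univ.filter fun z =>
    z ∉ B ∧ Sum.elim v y z ∉ Submodule.span ℝ
      (Sum.elim v y '' {b | b ∈ B ∧ Sum.Lex (· < ·) (· < ·) b z})

/-- The least space `Π(Θ)`. -/
def leastSpace (n : ℕ) (Θ : Finset (Fin n → ℝ)) : Submodule ℝ (MvPolynomial (Fin n) ℝ) :=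
  Submodule.span ℝ
    {f | ∃ (c : (Fin n → ℝ) → ℝ) (J : ℕ),
      f = (Nat.factorial J : ℝ)⁻¹ • ∑ θ ∈ Θ, c θ • pLin n θ ^ J ∧ f ≠ 0 ∧
      ∀ j < J, ∑ θ ∈ Θ, c θ • pLin n θ ^ j = 0}

/-- The central space `𝒫(X)`, spanned by the `p_Z` over short `Z`. -/
def centralP (n : ℕ) {ι : Type} [Fintype ι] [DecidableEq ι] (v : ι → Fin n → ℝ) :
    Submodule ℝ (MvPolynomial (Fin n) ℝ) :=
  Submodule.span ℝ
    {p | ∃ Z : Finset ι, Submodule.span ℝ (v '' ↑(Finset.univ \ Z)) = ⊤ ∧ p = pProd n v Z}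

end


theorem aux_card_basis {n : ℕ} {κ : Type} (w : κ → Fin n → ℝ) (B : Finset κ)
    (h : IsBasisSet n w B) : B.card = n := by
  obtain ⟨h1, h2⟩ := h
  have h3 := finrank_span_eq_card h1
  have h4 : Set.range (fun b : B => w b) = w '' ↑B := by
    ext x; simp
  rw [h4, h2] at h3
  simpa using h3.symm

theorem aux_card_parts {ι : Type} [Fintype ι] [DecidableEq ι] {M : ℕ}
    (B : Finset (ι ⊕ Fin M)) : (leftPart B).card + (rightPart B).card = B.card := by
  rw [← Finset.card_disjSum]
  congr 1
  ext z
  cases z <;> simp [leftPart, rightPart]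

theorem aux_card_Y {M : ℕ} (a b : ℕ) :
    ((YFin b \ YFin a : Finset (Fin M))).card ≤ b - a := by
  rw [← Nat.card_Ico]
  apply Finset.card_le_card_of_injOn (fun j : Fin M => (j : ℕ))
  · intro j hj
    simp [YFin] at hj ⊢
    omega
  · intro x _ z _ h
    exact Fin.ext h

/-- characterization of the bases `B' ∈ 𝔹_k` at whose vertex `Q_B` does
not vanish. -/
theorem statement10
    (n : ℕ) (hn : 1 ≤ n) (ι : Type) [Fintype ι] [DecidableEq ι]
    (v : ι → Fin n → ℝ) (M : ℕ) (y : Fin M → Fin n → ℝ)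
    (hspan : Submodule.span ℝ (Set.range (Sum.elim v y)) = ⊤)
    (hgen : GeneralPosition n v y)
    (k : Finset ι → ℕ) (hsolid : Solid n v k)
    (hM : ∀ I : Finset ι, (LinearIndependent ℝ fun i : I => v i) → mVal n k I ≤ M)
    (lam : ι ⊕ Fin M → ℝ) (bp : Finset (ι ⊕ Fin M) → Fin n → ℝ)
    (hgeneric : Generic n (Sum.elim v y) lam bp)
    (B : Finset (ι ⊕ Fin M)) (hB : B ∈ Bk n v y k)
    (B' : Finset (ι ⊕ Fin M)) (hB' : B' ∈ Bk n v y k) :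
    MvPolynomial.eval (bp B')
        (qProd n (Sum.elim v y) lam (XYup ι M (mVal n k (leftPart B)) \ B)) ≠ 0 ↔
      (leftPart B' ⊆ leftPart B ∧
       rightPart B' ∩ YFin (mVal n k (leftPart B)) = rightPart B ∧
       k (leftPart B') = k (leftPart B) ∧
       rightPart B' \ rightPart B =
         YFin (mVal n k (leftPart B')) \ YFin (mVal n k (leftPart B))) := by
  obtain ⟨hb, hy⟩ := hB
  obtain ⟨hb', hy'⟩ := hB'
  have key : MvPolynomial.eval (bp B')
        (qProd n (Sum.elim v y) lam (XYup ι M (mVal n k (leftPart B)) \ B)) ≠ 0 ↔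
      (leftPart B' ⊆ leftPart B ∧
       rightPart B' ∩ YFin (mVal n k (leftPart B)) ⊆ rightPart B) := by
    rw [qProd, map_prod, Finset.prod_ne_zero_iff]
    simp only [ne_eq, hgeneric B' hb']
    constructor
    · intro h
      constructor
      · intro i hi
        have := h (Sum.inl i)
        simp [leftPart, XYup] at hi this ⊢
        tauto
      · intro i hi
        have := h (Sum.inr i)
        simp [rightPart, XYup] at hi this ⊢
        tauto
    · rintro ⟨h1, h2⟩ z hz hzB
      rcases z with i | i
      · have := @h1 i
        simp [leftPart] at this hz
        tauto
      · have := @h2 i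
        simp [rightPart, XYup] at this hz
        tauto
  rw [key]
  constructor
  swap
  · rintro ⟨h1, h2, -, -⟩
    exact ⟨h1, h2.le⟩
  rintro ⟨h1, h2⟩
  have c := aux_card_parts B
  have c' := aux_card_parts B'
  rw [aux_card_basis _ _ hb] at c
  rw [aux_card_basis _ _ hb'] at c'
  have hk : k (leftPart B') ≤ k (leftPart B) :=
    hsolid _ _ (Submodule.span_mono (Set.image_mono (by exact_mod_cast h1)))
  have hI := Finset.card_le_card h1
  have hJ := Finset.card_le_card h2
  have hsub : rightPart B' \ YFin (mVal n k (leftPart B)) ⊆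
      YFin (mVal n k (leftPart B')) \ YFin (mVal n k (leftPart B)) := by
    apply Finset.sdiff_subset_sdiff _ le_rfl
    intro j hj
    simp [rightPart, YFin] at hj ⊢
    exact hy' j hj
  have hS := Finset.card_le_card hsub
  have hY := aux_card_Y (M := M) (mVal n k (leftPart B)) (mVal n k (leftPart B'))
  have hsplit := Finset.card_inter_add_card_sdiff (rightPart B') (YFin (mVal n k (leftPart B)))
  have hm : mVal n k (leftPart B) = k (leftPart B) + n - (leftPart B).card := rfl
  have hm' : mVal n k (leftPart B') = k (leftPart B') + n - (leftPart B').card := rfl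
  have hkk : k (leftPart B') = k (leftPart B) := by
    by_cases hd : (leftPart B').card = (leftPart B).card
    · rw [Finset.eq_of_subset_of_card_le h1 hd.ge]
    · omega
  have e2 : rightPart B' ∩ YFin (mVal n k (leftPart B)) = rightPart B :=
    Finset.eq_of_subset_of_card_le h2 (by omega)
  have e4 := Finset.eq_of_subset_of_card_le hsub (by omega)
  refine ⟨h1, e2, hkk, ?_⟩
  rw [← e4, ← e2]
  exact Finset.sdiff_inter_self_left _ _
end

section
/- Let k be a solid and incremental assignment and assume the constants (λ_z)_{z∈X∪Y} are generic. Then the polynomials Q_B := q_{(X ∪ Y_{m(B∩X)})∖B}, B ∈ 𝔹_k, form a basis of 𝒫_k; in particular dim 𝒫_k = #𝔹_k. -/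
open MvPolynomial

theorem aux_totalDeg_pLin (n : ℕ) (x : Fin n → ℝ) : (pLin n x).totalDegree ≤ 1 := by
  unfold pLin
  refine (totalDegree_finsetSum _ _).trans (Finset.sup_le fun i _ => ?_)
  refine (totalDegree_mul _ _).trans ?_
  simp

noncomputable def qL (n : ℕ) {κ : Type} (w : κ → Fin n → ℝ) (lam : κ → ℝ) (z : κ) : MvPolynomial (Fin n) ℝ :=
  pLin n (w z) - C (lam z)

theorem aux_totalDeg_qL (n : ℕ) {κ : Type} (w : κ → Fin n → ℝ) (lam : κ → ℝ) (z : κ) :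
    (qL n w lam z).totalDegree ≤ 1 := by
  unfold qL
  refine (totalDegree_sub _ _).trans (max_le (aux_totalDeg_pLin n _) (by simp))

theorem aux_totalDeg_qProd (n : ℕ) {κ : Type} (w : κ → Fin n → ℝ) (lam : κ → ℝ) (Z : Finset κ) :
    (∏ z ∈ Z, qL n w lam z).totalDegree ≤ Z.card := by
  refine (totalDegree_finsetProd _ _).trans ?_
  refine (Finset.sum_le_card_nsmul _ _ 1 fun z _ => aux_totalDeg_qL n w lam z).trans ?_
  simp

theorem aux_pLin_sum (n : ℕ) {κ : Type} (w : κ → Fin n → ℝ) (c : κ → ℝ) (Z : Finset κ) :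
    ∑ z ∈ Z, C (c z) * pLin n (w z) = pLin n (∑ z ∈ Z, c z • w z) := by
  unfold pLin
  simp only [Finset.mul_sum]
  rw [Finset.sum_comm]
  refine Finset.sum_congr rfl fun i _ => ?_
  simp only [Finset.sum_apply, Pi.smul_apply, smul_eq_mul, map_sum, Finset.sum_mul, map_mul, mul_assoc]

theorem aux_qL_sum (n : ℕ) {κ : Type} (w : κ → Fin n → ℝ) (lam c : κ → ℝ) (Z : Finset κ) :
    ∑ z ∈ Z, C (c z) * qL n w lam z =
      pLin n (∑ z ∈ Z, c z • w z) - C (∑ z ∈ Z, c z * lam z) := by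
  rw [← aux_pLin_sum]
  simp [qL, mul_sub, Finset.sum_sub_distrib]

theorem aux_mem_span (n : ℕ) {κ : Type} [DecidableEq κ] (w : κ → Fin n → ℝ) (Z : Finset κ)
    (u : Fin n → ℝ) (hu : u ∈ Submodule.span ℝ (w '' ↑Z)) :
    ∃ c : κ → ℝ, (∀ z, z ∉ Z → c z = 0) ∧ ∑ z ∈ Z, c z • w z = u := by
  rw [Submodule.mem_span_image_finset_iff_exists_fun] at hu
  obtain ⟨c, hc⟩ := hu
  refine ⟨fun z => if h : z ∈ Z then c ⟨z, h⟩ else 0, fun z hz => by simp [hz], ?_⟩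
  rw [← hc, ← Finset.sum_coe_sort]
  exact Finset.sum_congr rfl fun z _ => by simp

theorem aux_rel (n : ℕ) {κ : Type} [Fintype κ] [DecidableEq κ] (w : κ → Fin n → ℝ)
    (hspan : Submodule.span ℝ (Set.range w) = ⊤) (lam : κ → ℝ) (bp : Finset κ → Fin n → ℝ)
    (hg : Generic n w lam bp) (Z : Finset κ) (hZ : ¬ LinearIndepOn ℝ w (Z : Set κ)) :
    ∃ c : κ → ℝ, ∑ z ∈ Z, c z • w z = 0 ∧ ∑ z ∈ Z, C (c z) * qL n w lam z = 1 := by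
  classical
  obtain ⟨I, hIZ, -, hIspan, hI⟩ :=
    exists_linearIndepOn_extension (linearIndepOn_empty ℝ w) (Set.empty_subset (Z : Set κ))
  obtain ⟨b, -, hIb, hbspan, hb⟩ := exists_linearIndepOn_extension hI (Set.subset_univ I)
  have hne : ∃ x ∈ Z, x ∉ I := by
    by_contra! h
    exact hZ (hI.mono h)
  obtain ⟨x, hxZ, hxI⟩ := hne
  have hxs : w x ∈ Submodule.span ℝ (w '' I) := hIspan ⟨x, hxZ, rfl⟩
  have hxb : x ∉ b := by
    intro hxb
    have := (hb.mono (Set.insert_subset hxb hIb)).notMem_span_of_insert hxI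
    exact this hxs
  have hB : IsBasisSet n w b.toFinset := by
    constructor
    · have : LinearIndepOn ℝ w (b.toFinset : Set κ) := by simpa using hb
      exact this
    · rw [Set.coe_toFinset, eq_top_iff, ← hspan, Submodule.span_le, ← Set.image_univ]
      exact hbspan
  have hI' : (I.toFinset : Set κ) = I := Set.coe_toFinset I
  obtain ⟨a, ha0, ha⟩ := aux_mem_span n w I.toFinset (w x) (by rwa [hI'])
  have haZ : ∑ z ∈ Z, a z • w z = w x := by
    rw [← ha]
    symm
    apply Finset.sum_subset
    · intro z hz
      exact hIZ (by simpa using hz)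
    · intro z _ hz
      simp [ha0 z hz]
  set d : κ → ℝ := fun z => (if z = x then 1 else 0) - a z with hd
  have hdw : ∑ z ∈ Z, d z • w z = 0 := by
    simp [hd, sub_smul, Finset.sum_sub_distrib, haZ, hxZ]
  have hq := aux_qL_sum n w lam d Z
  rw [hdw] at hq
  have h0 : pLin n 0 = 0 := by simp [pLin]
  rw [h0, zero_sub, ← map_neg] at hq
  set t := -∑ z ∈ Z, d z * lam z with ht
  have htne : t ≠ 0 := by
    intro ht0
    rw [ht0, map_zero] at hq
    have hev := congrArg (eval (bp b.toFinset)) hq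
    rw [map_sum, map_zero, Finset.sum_eq_single x] at hev
    · have hdx : d x = 1 := by
        have : a x = 0 := ha0 x (by simpa using hxI)
        simp [hd, this]
      rw [hdx, map_one, one_mul] at hev
      have := (hg _ hB x).1 hev
      exact hxb (by simpa using this)
    · intro z hz hzx
      rw [map_mul]
      by_cases hzI : z ∈ I
      · have : eval (bp b.toFinset) (qL n w lam z) = 0 :=
          (hg _ hB z).2 (by simpa using hIb hzI)
        rw [this, mul_zero]
      · have : d z = 0 := by
          simp [hd, hzx, ha0 z (by simpa using hzI)]
        simp [this]
    · intro h
      exact absurd hxZ h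
  refine ⟨fun z => t⁻¹ * d z, ?_, ?_⟩
  · simp only [mul_smul, ← Finset.smul_sum, hdw, smul_zero]
  · simp only [map_mul, mul_assoc, ← Finset.mul_sum, hq]
    rw [← map_mul, inv_mul_cancel₀ htne, map_one]

theorem aux_decomp (n : ℕ) {κ : Type} [Fintype κ] [DecidableEq κ] (w : κ → Fin n → ℝ)
    (hspan : Submodule.span ℝ (Set.range w) = ⊤) (lam : κ → ℝ) (bp : Finset κ → Fin n → ℝ)
    (hg : Generic n w lam bp) (Z : Finset κ) (hZ : ¬ LinearIndepOn ℝ w (Z : Set κ))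
    (hZs : Submodule.span ℝ (w '' (Z : Set κ)) = ⊤) (j : ℕ) (T : Submodule ℝ (MvPolynomial (Fin n) ℝ))
    (hT : ∀ z ∈ Z, ∀ g : MvPolynomial (Fin n) ℝ, g.totalDegree ≤ j → qL n w lam z * g ∈ T)
    (f : MvPolynomial (Fin n) ℝ) (hf : f.totalDegree ≤ j + 1) : f ∈ T := by
  classical
  obtain ⟨c, hcw, hc1⟩ := aux_rel n w hspan lam bp hg Z hZ
  have hlin : ∀ (d : κ → ℝ) (g : MvPolynomial (Fin n) ℝ), g.totalDegree ≤ j →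
      (∑ z ∈ Z, C (d z) * qL n w lam z) * g ∈ T := by
    intro d g hg
    rw [Finset.sum_mul]
    refine Submodule.sum_mem _ fun z hz => ?_
    rw [mul_assoc, ← smul_eq_C_mul]
    exact T.smul_mem _ (hT z hz g hg)
  have hone : ∀ g : MvPolynomial (Fin n) ℝ, g.totalDegree ≤ j → g ∈ T := by
    intro g hg
    have := hlin c g hg
    rwa [hc1, one_mul] at this
  have hX : ∀ (i : Fin n) (g : MvPolynomial (Fin n) ℝ), g.totalDegree ≤ j → X i * g ∈ T := by
    intro i g hg
    obtain ⟨d, -, hd⟩ := aux_mem_span n w Z (Pi.single i 1) (by rw [hZs]; trivial)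
    have hp : pLin n (Pi.single i 1) = X i := by
      unfold pLin
      rw [Finset.sum_eq_single i]
      · simp
      · intro k _ hk
        simp [hk]
      · simp
    have hs := aux_qL_sum n w lam d Z
    rw [hd, hp, eq_sub_iff_add_eq] at hs
    rw [← hs, add_mul, ← smul_eq_C_mul]
    exact T.add_mem (hlin d g hg) (T.smul_mem _ (hone g hg))
  rw [f.as_sum]
  refine Submodule.sum_mem _ fun s hs => ?_
  have hsd := (le_totalDegree hs).trans hf
  by_cases h : (s.sum fun _ e => e) ≤ j
  · exact hone _ ((totalDegree_monomial_le _ _).trans h)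
  · have hs0 : s ≠ 0 := by
      rintro rfl
      simp at h
    obtain ⟨i, hi⟩ := Finsupp.ne_iff.1 hs0
    have hle : Finsupp.single i 1 ≤ s := by
      rw [Finsupp.single_le_iff]
      exact Nat.one_le_iff_ne_zero.2 hi
    obtain ⟨s', rfl⟩ := exists_add_of_le hle
    have : monomial (Finsupp.single i 1 + s') (coeff (Finsupp.single i 1 + s') f)
        = X i * monomial s' (coeff (Finsupp.single i 1 + s') f) := by
      rw [X, monomial_mul, one_mul]
    rw [this]
    refine hX i _ ((totalDegree_monomial_le _ _).trans ?_)
    rw [Finsupp.sum_add_index' (by simp) (by simp)] at hsd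
    simp only [Finsupp.sum_single_index] at hsd
    change (s'.sum fun _ e => e) ≤ j
    omega

theorem aux_disjSum_parts {ι : Type} [Fintype ι] [DecidableEq ι] {M : ℕ} (B : Finset (ι ⊕ Fin M)) :
    (leftPart B).disjSum (rightPart B) = B := by
  ext z
  rcases z with z | z <;> simp [leftPart, rightPart]

theorem aux_leftPart {ι : Type} [Fintype ι] [DecidableEq ι] {M : ℕ} (I : Finset ι)
    (S : Finset (Fin M)) : leftPart (I.disjSum S) = I := by
  ext z
  simp [leftPart]

theorem aux_sdiff {ι : Type} [Fintype ι] [DecidableEq ι] {M : ℕ} (m : ℕ) (I : Finset ι)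
    (S : Finset (Fin M)) :
    XYup ι M m \ (I.disjSum S) = (Finset.univ \ I).disjSum (YFin m \ S) := by
  ext z
  rcases z with z | z <;> simp [XYup]

theorem aux_qProd {ι : Type} [Fintype ι] [DecidableEq ι] {M : ℕ} (n m : ℕ)
    (w : ι ⊕ Fin M → Fin n → ℝ) (lam : ι ⊕ Fin M → ℝ) (I : Finset ι) (S : Finset (Fin M)) :
    qProd n w lam (XYup ι M m \ (I.disjSum S)) =
      (∏ a ∈ Finset.univ \ I, qL n w lam (Sum.inl a)) *
      ∏ b ∈ YFin m \ S, qL n w lam (Sum.inr b) := by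
  rw [aux_sdiff]
  unfold qProd
  rw [Finset.prod_disjSum]
  rfl

theorem aux_card_YFin {M m : ℕ} (h : m ≤ M) : (YFin (M := M) m).card = m := by
  unfold YFin
  rw [Fin.card_filter_val_lt]
  exact min_eq_right h

theorem aux_totalDeg_qProd_inr (n : ℕ) {ι : Type} {M : ℕ} (w : ι ⊕ Fin M → Fin n → ℝ)
    (lam : ι ⊕ Fin M → ℝ) (Z : Finset (Fin M)) :
    (∏ z ∈ Z, qL n w lam (Sum.inr z)).totalDegree ≤ Z.card :=
  aux_totalDeg_qProd n (fun z => w (Sum.inr z)) (fun z => lam (Sum.inr z)) Z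

theorem aux_indep (n : ℕ) {ι : Type} [Fintype ι] [DecidableEq ι] {M : ℕ}
    (v : ι → Fin n → ℝ) (y : Fin M → Fin n → ℝ) (hgen : GeneralPosition n v y)
    (I : Finset ι) (hI : LinearIndepOn ℝ v (I : Set ι)) (S : Finset (Fin M))
    (hS : I.card + S.card ≤ n) :
    LinearIndepOn ℝ (Sum.elim v y) (I.disjSum S : Set (ι ⊕ Fin M)) := by
  induction S using Finset.induction_on with
  | empty =>
    have h1 : LinearIndepOn ℝ (Sum.elim v y ∘ Sum.inl) (I : Set ι) := by simpa using hI
    have := LinearIndepOn.image_of_comp Sum.inl (Sum.elim v y) h1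
    convert this
    ext z
    rcases z with z | z <;> simp
  | insert j S hj ih =>
    rw [Finset.card_insert_of_notMem hj] at hS
    have h1 := ih (by omega)
    have h2 := hgen j (I.disjSum S) (by simpa using hj) (by rw [Finset.card_disjSum]; omega)
    have h3 := LinearIndepOn.insert (x := Sum.inr j) h1 (by simpa using h2)
    have h4 : (I.disjSum (insert j S) : Set (ι ⊕ Fin M)) =
        insert (Sum.inr j) (I.disjSum S : Set (ι ⊕ Fin M)) := by
      ext z
      rcases z with z | z <;> simp
    rw [h4]
    exact h3

theorem aux_basis (n : ℕ) {κ : Type} (w : κ → Fin n → ℝ) (B : Finset κ)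
    (hB : LinearIndepOn ℝ w (B : Set κ)) (hc : B.card = n) : IsBasisSet n w B := by
  refine ⟨hB, ?_⟩
  have h : LinearIndependent ℝ (fun b : B => w b) := hB
  have := h.span_eq_top_of_card_eq_finrank' (by simp [hc])
  rw [← this]
  congr 1
  ext u
  simp

theorem aux_basis_card (n : ℕ) {κ : Type} (w : κ → Fin n → ℝ) (B : Finset κ)
    (hB : IsBasisSet n w B) : B.card = n := by
  have h : LinearIndependent ℝ (fun b : B => w b) := hB.1
  have h2 : Submodule.span ℝ (Set.range (fun b : B => w b)) = ⊤ := by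
    rw [← hB.2]
    congr 1
    ext u
    simp
  have := Module.finrank_eq_card_basis (Module.Basis.mk h h2.ge)
  simpa using this.symm

theorem aux_card_le (n : ℕ) {κ : Type} (w : κ → Fin n → ℝ) (B : Finset κ)
    (hB : LinearIndepOn ℝ w (B : Set κ)) : B.card ≤ n := by
  have h : LinearIndependent ℝ (fun b : B => w b) := hB
  simpa using h.fintype_card_le_finrank

theorem aux_span (n : ℕ) {ι : Type} [Fintype ι] [DecidableEq ι]
    (v : ι → Fin n → ℝ) (M : ℕ) (y : Fin M → Fin n → ℝ)
    (hspan : Submodule.span ℝ (Set.range (Sum.elim v y)) = ⊤)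
    (hgen : GeneralPosition n v y)
    (k : Finset ι → ℕ) (hsolid : Solid n v k)
    (hM : ∀ I : Finset ι, (LinearIndependent ℝ fun i : I => v i) → mVal n k I ≤ M)
    (hinc : Incremental k)
    (lam : ι ⊕ Fin M → ℝ) (bp : Finset (ι ⊕ Fin M) → Fin n → ℝ)
    (hgeneric : Generic n (Sum.elim v y) lam bp)
    (W : Submodule ℝ (MvPolynomial (Fin n) ℝ))
    (hW : ∀ B ∈ Bk n v y k, qProd n (Sum.elim v y) lam (XYup ι M (mVal n k (leftPart B)) \ B) ∈ W)
    (Z : Finset ι) : ∀ (f : MvPolynomial (Fin n) ℝ), f.totalDegree ≤ k Z →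
      (∏ a ∈ Finset.univ \ Z, qL n (Sum.elim v y) lam (Sum.inl a)) * f ∈ W := by
  induction Z using Finset.strongInduction with
  | H Z ih =>
  have herase : ∀ x ∈ Z, (∏ a ∈ Finset.univ \ Z.erase x, qL n (Sum.elim v y) lam (Sum.inl a)) =
      qL n (Sum.elim v y) lam (Sum.inl x) *
        ∏ a ∈ Finset.univ \ Z, qL n (Sum.elim v y) lam (Sum.inl a) := by
    intro x hx
    rw [← Finset.prod_insert (s := Finset.univ \ Z) (a := x)
      (f := fun a => qL n (Sum.elim v y) lam (Sum.inl a)) (by simpa using hx)]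
    congr 1
    ext a
    by_cases h : a = x <;> simp [h]
  by_cases hZ : LinearIndepOn ℝ v (Z : Set ι)
  · -- independent case
    intro f hf
    have hZn := aux_card_le n v Z hZ
    have hmM := hM Z hZ
    have hYc := aux_card_YFin hmM
    set m := mVal n k Z with hm
    have hmv : m + Z.card = k Z + n := by
      rw [hm, mVal]; omega
    suffices H : ∀ (j : ℕ) (S : Finset (Fin M)), S ⊆ YFin m → S.card + Z.card = n + j →
        ∀ f : MvPolynomial (Fin n) ℝ, f.totalDegree ≤ j →
        (∏ a ∈ Finset.univ \ Z, qL n (Sum.elim v y) lam (Sum.inl a)) *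
          (∏ b ∈ YFin m \ S, qL n (Sum.elim v y) lam (Sum.inr b)) * f ∈ W by
      have := H (k Z) (YFin m) (Finset.Subset.refl _) (by omega) f hf
      simpa using this
    intro j
    induction j with
    | zero =>
      intro S hS hSc f hf
      have hf' := totalDegree_eq_zero_iff_eq_C.1 (Nat.le_zero.1 hf)
      rw [hf', mul_comm, ← smul_eq_C_mul]
      refine W.smul_mem _ ?_
      have hB : Z.disjSum S ∈ Bk n v y k := by
        refine ⟨aux_basis n _ _ (aux_indep n v y hgen Z hZ S (by omega)) ?_, ?_⟩
        · rw [Finset.card_disjSum]; omega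
        · intro b hb
          have := hS (by simpa using hb)
          rw [aux_leftPart]
          simpa [YFin] using this
      have := hW _ hB
      rwa [aux_leftPart, aux_qProd] at this
    | succ j ihj =>
      intro S hS hSc f hf
      have hdeg : (YFin m \ S).card + j + 1 = k Z := by
        rw [Finset.card_sdiff_of_subset hS]
        have := Finset.card_le_card hS
        omega
      obtain ⟨S', hS'S, hS'c⟩ := Finset.exists_subset_card_eq (s := S) (n := n - Z.card) (by omega)
      have hbas := aux_basis n _ _ (aux_indep n v y hgen Z hZ S' (by omega))
        (by rw [Finset.card_disjSum]; omega)
      have key := aux_decomp n (Sum.elim v y) hspan lam bp hgeneric (Z.disjSum S) ?_ ?_ j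
        (W.comap (LinearMap.mulLeft ℝ
          ((∏ a ∈ Finset.univ \ Z, qL n (Sum.elim v y) lam (Sum.inl a)) *
          (∏ b ∈ YFin m \ S, qL n (Sum.elim v y) lam (Sum.inr b))))) ?_ f hf
      · exact key
      · intro h
        have := aux_card_le n _ _ h
        rw [Finset.card_disjSum] at this
        omega
      · rw [eq_top_iff, ← hbas.2]
        refine Submodule.span_mono (Set.image_mono ?_)
        exact_mod_cast Finset.disjSum_mono (Finset.Subset.refl Z) hS'S
      · intro z hz g hg
        simp only [Submodule.mem_comap, LinearMap.mulLeft_apply]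
        rcases z with x | t
        · have hx : x ∈ Z := by simpa using hz
          have h1 := ih (Z.erase x) (Finset.erase_ssubset hx)
            ((∏ b ∈ YFin m \ S, qL n (Sum.elim v y) lam (Sum.inr b)) * g) ?_
          · rw [herase x hx] at h1
            convert h1 using 1
            ring
          · have h2 := hinc (Z.erase x) x
            rw [Finset.insert_erase hx] at h2
            have h3 := totalDegree_mul (∏ b ∈ YFin m \ S, qL n (Sum.elim v y) lam (Sum.inr b)) g
            have h4 := aux_totalDeg_qProd_inr n (Sum.elim v y) lam (YFin m \ S)
            omega
        · have ht : t ∈ S := by simpa using hz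
          have h1 := ihj (S.erase t) ((Finset.erase_subset _ _).trans hS)
            (by rw [Finset.card_erase_of_mem ht]; have := Finset.card_pos.2 ⟨t, ht⟩; omega) g hg
          have h2 : (∏ b ∈ YFin m \ S.erase t, qL n (Sum.elim v y) lam (Sum.inr b)) =
              qL n (Sum.elim v y) lam (Sum.inr t) *
              ∏ b ∈ YFin m \ S, qL n (Sum.elim v y) lam (Sum.inr b) := by
            rw [← Finset.prod_insert (s := YFin m \ S) (a := t)
              (f := fun a => qL n (Sum.elim v y) lam (Sum.inr a)) (by simp [ht])]
            congr 1
            have := hS ht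
            ext a
            by_cases h : a = t
            · subst h; simp [this]
            · simp [h]
          rw [h2] at h1
          convert h1 using 1
          ring
  · intro f hf
    have hZ' : ¬ LinearIndepOn ℝ (Sum.elim v y) ((Z.disjSum (∅ : Finset (Fin M)) : Finset (ι ⊕ Fin M)) : Set (ι ⊕ Fin M)) := by
      intro h
      apply hZ
      have : LinearIndepOn ℝ (Sum.elim v y) (Sum.inl '' (Z : Set ι)) := by
        refine h.mono ?_
        rintro _ ⟨a, ha, rfl⟩
        simpa using ha
      simpa using this.comp_of_image Sum.inl_injective.injOn
    obtain ⟨d, hd0, hd1⟩ := aux_rel n (Sum.elim v y) hspan lam bp hgeneric _ hZ'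
    rw [Finset.sum_disjSum, Finset.sum_empty, add_zero] at hd0 hd1
    simp only [Sum.elim_inl] at hd0
    rw [← mul_one f, ← hd1, Finset.mul_sum, Finset.mul_sum]
    refine Submodule.sum_mem _ fun x hx => ?_
    by_cases hdx : d (Sum.inl x) = 0
    · simp [hdx]
    have hk : k Z ≤ k (Z.erase x) := by
      apply hsolid
      rw [Submodule.span_le]
      rintro _ ⟨a, ha, rfl⟩
      by_cases hax : a = x
      · subst hax
        rw [← Finset.add_sum_erase _ _ hx] at hd0
        have h1 : v a = (-(d (Sum.inl a))⁻¹) • ∑ b ∈ Z.erase a, d (Sum.inl b) • v b := by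
          rw [eq_neg_of_add_eq_zero_right hd0, smul_neg, neg_smul, neg_neg, smul_smul,
            inv_mul_cancel₀ hdx, one_smul]
        rw [h1]
        refine Submodule.smul_mem _ _ (Submodule.sum_mem _ fun b hb => Submodule.smul_mem _ _ ?_)
        exact Submodule.subset_span ⟨b, hb, rfl⟩
      · exact Submodule.subset_span ⟨a, by simpa [hax] using ha, rfl⟩
    have h1 := ih (Z.erase x) (Finset.erase_ssubset hx) f (hf.trans hk)
    rw [herase x hx] at h1
    have h2 := W.smul_mem (d (Sum.inl x)) h1
    rw [smul_eq_C_mul] at h2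
    convert h2 using 1
    ring

theorem aux_expand (n : ℕ) {ι : Type} [Fintype ι] [DecidableEq ι]
    (u : ι → MvPolynomial (Fin n) ℝ) (e : ι → ℝ) (k : Finset ι → ℕ)
    (hk : ∀ Z Z' : Finset ι, Z ⊆ Z' → k Z ≤ k Z')
    (W : Submodule ℝ (MvPolynomial (Fin n) ℝ))
    (h : ∀ (Z : Finset ι) (f : MvPolynomial (Fin n) ℝ), f.totalDegree ≤ k Z →
      (∏ a ∈ Finset.univ \ Z, u a) * f ∈ W)
    (Z : Finset ι) (f : MvPolynomial (Fin n) ℝ) (hf : f.totalDegree ≤ k Z) :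
    (∏ a ∈ Finset.univ \ Z, (u a + C (e a))) * f ∈ W := by
  rw [Finset.prod_add, Finset.sum_mul]
  refine Submodule.sum_mem _ fun T hT => ?_
  rw [Finset.mem_powerset] at hT
  have h1 := h (Finset.univ \ T) f (hf.trans (hk _ _ ?_))
  · have h2 := W.smul_mem (∏ i ∈ (Finset.univ \ Z) \ T, e i) h1
    rw [smul_eq_C_mul, map_prod, sdiff_sdiff_right_self, Finset.inf_eq_inter,
      Finset.univ_inter] at h2
    convert h2 using 1
    ring
  · intro a ha
    have : a ∉ T := fun h' => by simpa [ha] using hT h'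
    simpa using this

theorem aux_mono (n : ℕ) {ι : Type} (v : ι → Fin n → ℝ) (k : Finset ι → ℕ)
    (hs : Solid n v k) (Z Z' : Finset ι) (h : Z ⊆ Z') : k Z ≤ k Z' :=
  hs _ _ (Submodule.span_mono (Set.image_mono (by exact_mod_cast h)))

theorem aux_inc {ι : Type} [DecidableEq ι] (k : Finset ι → ℕ) (hinc : Incremental k)
    (I D : Finset ι) : k (I ∪ D) ≤ k I + D.card := by
  induction D using Finset.induction_on with
  | empty => simp
  | insert a D ha ih =>
    rw [Finset.union_insert, Finset.card_insert_of_notMem ha]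
    have := hinc (I ∪ D) a
    omega

theorem aux_m {ι : Type} [DecidableEq ι] (n : ℕ) (k : Finset ι → ℕ) (hinc : Incremental k)
    (I I' : Finset ι) (h : I ⊆ I') : mVal n k I' ≤ mVal n k I := by
  have h1 := aux_inc k hinc I (I' \ I)
  rw [Finset.union_sdiff_of_subset h, Finset.card_sdiff_of_subset h] at h1
  have := Finset.card_le_card h
  unfold mVal
  omega

theorem aux_leftIndep (n : ℕ) {ι : Type} [Fintype ι] [DecidableEq ι] {M : ℕ}
    (v : ι → Fin n → ℝ) (y : Fin M → Fin n → ℝ) (B : Finset (ι ⊕ Fin M))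
    (hB : IsBasisSet n (Sum.elim v y) B) : LinearIndepOn ℝ v (leftPart B : Set ι) := by
  have h : LinearIndepOn ℝ (Sum.elim v y) (B : Set (ι ⊕ Fin M)) := hB.1
  have : LinearIndepOn ℝ (Sum.elim v y) (Sum.inl '' (leftPart B : Set ι)) := by
    refine h.mono ?_
    rintro _ ⟨a, ha, rfl⟩
    simpa [leftPart] using ha
  simpa using this.comp_of_image Sum.inl_injective.injOn

theorem aux_li (n : ℕ) {ι : Type} [Fintype ι] [DecidableEq ι]
    (v : ι → Fin n → ℝ) (M : ℕ) (y : Fin M → Fin n → ℝ)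
    (k : Finset ι → ℕ) (hinc : Incremental k)
    (lam : ι ⊕ Fin M → ℝ) (bp : Finset (ι ⊕ Fin M) → Fin n → ℝ)
    (hgeneric : Generic n (Sum.elim v y) lam bp) :
    LinearIndependent ℝ (fun B : Bk n v y k =>
      qProd n (Sum.elim v y) lam
        (XYup ι M (mVal n k (leftPart (B : Finset (ι ⊕ Fin M)))) \ (B : Finset (ι ⊕ Fin M)))) := by
  have hev : ∀ B B' : Bk n v y k, eval (bp B') (qProd n (Sum.elim v y) lam
        (XYup ι M (mVal n k (leftPart (B : Finset (ι ⊕ Fin M)))) \ (B : Finset (ι ⊕ Fin M)))) = 0 ↔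
        ∃ z ∈ XYup ι M (mVal n k (leftPart (B : Finset (ι ⊕ Fin M)))) \ (B : Finset (ι ⊕ Fin M)),
          z ∈ (B' : Finset (ι ⊕ Fin M)) := by
    intro B B'
    unfold qProd
    rw [map_prod, Finset.prod_eq_zero_iff]
    refine exists_congr fun z => and_congr_right fun _ => ?_
    exact hgeneric _ B'.2.1 z
  have hne : ∀ B B' : Bk n v y k, B ≠ B' →
      (leftPart (B : Finset (ι ⊕ Fin M))).card ≤ (leftPart (B' : Finset (ι ⊕ Fin M))).card →
      eval (bp B') (qProd n (Sum.elim v y) lam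
        (XYup ι M (mVal n k (leftPart (B : Finset (ι ⊕ Fin M)))) \ (B : Finset (ι ⊕ Fin M)))) = 0 := by
    intro B B' hBB hc
    by_contra h
    rw [hev] at h
    push Not at h
    have hl : leftPart (B' : Finset (ι ⊕ Fin M)) ⊆ leftPart (B : Finset (ι ⊕ Fin M)) := by
      intro a ha
      by_contra ha'
      exact h (Sum.inl a) (by simpa [XYup, leftPart] using ha') (by simpa [leftPart] using ha)
    have hl' := Finset.eq_of_subset_of_card_le hl hc
    have hsub : (B' : Finset (ι ⊕ Fin M)) ⊆ B := by
      intro z hz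
      by_contra hzB
      refine h z ?_ hz
      rw [Finset.mem_sdiff]
      refine ⟨?_, hzB⟩
      rcases z with a | b
      · simp [XYup]
      · have := B'.2.2 b hz
        rw [hl'] at this
        simpa [XYup, YFin] using this
    apply hBB
    apply Subtype.ext
    refine (Finset.eq_of_subset_of_card_le hsub ?_).symm
    rw [aux_basis_card n _ _ B.2.1, aux_basis_card n _ _ B'.2.1]
  rw [linearIndependent_iff']
  intro s g hsum
  have main : ∀ (d : ℕ) (B' : Bk n v y k), B' ∈ s →
      Fintype.card ι - (leftPart (B' : Finset (ι ⊕ Fin M))).card = d → g B' = 0 := by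
    intro d
    induction d using Nat.strong_induction_on with
    | _ d ih =>
    intro B' hB' hd
    have h1 := congrArg (eval (bp B')) hsum
    rw [map_sum, map_zero, Finset.sum_eq_single B'] at h1
    · rw [smul_eval] at h1
      refine (mul_eq_zero.1 h1).resolve_right ?_
      rw [hev]
      rintro ⟨z, hz, hz'⟩
      exact (Finset.mem_sdiff.1 hz).2 hz'
    · intro B hB hBB
      rw [smul_eval]
      by_cases hc : (leftPart (B : Finset (ι ⊕ Fin M))).card ≤
          (leftPart (B' : Finset (ι ⊕ Fin M))).card
      · rw [hne B B' hBB hc, mul_zero]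
      · have hle := Finset.card_le_univ (leftPart (B : Finset (ι ⊕ Fin M)))
        rw [ih _ (by omega) B hB rfl, zero_mul]
    · intro h
      exact absurd hB' h
  intro B hB
  exact main _ B hB rfl

/-- for a solid and incremental assignment and generic constants, the
polynomials `Q_B = q_{(X ∪ Y_{m(B∩X)}) ∖ B}`, `B ∈ 𝔹_k`, form a basis of `𝒫_k`;
in particular `dim 𝒫_k = #𝔹_k`. -/
theorem statement11
    (n : ℕ) (hn : 1 ≤ n) (ι : Type) [Fintype ι] [DecidableEq ι]
    (v : ι → Fin n → ℝ) (M : ℕ) (y : Fin M → Fin n → ℝ)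
    (hspan : Submodule.span ℝ (Set.range (Sum.elim v y)) = ⊤)
    (hgen : GeneralPosition n v y)
    (k : Finset ι → ℕ) (hsolid : Solid n v k)
    (hM : ∀ I : Finset ι, (LinearIndependent ℝ fun i : I => v i) → mVal n k I ≤ M)
    (hinc : Incremental k)
    (lam : ι ⊕ Fin M → ℝ) (bp : Finset (ι ⊕ Fin M) → Fin n → ℝ)
    (hgeneric : Generic n (Sum.elim v y) lam bp) :
    LinearIndependent ℝ (fun B : Bk n v y k =>
      qProd n (Sum.elim v y) lam
        (XYup ι M (mVal n k (leftPart (B : Finset (ι ⊕ Fin M)))) \ (B : Finset (ι ⊕ Fin M)))) ∧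
    Submodule.span ℝ (Set.range fun B : Bk n v y k =>
      qProd n (Sum.elim v y) lam
        (XYup ι M (mVal n k (leftPart (B : Finset (ι ⊕ Fin M)))) \ (B : Finset (ι ⊕ Fin M))))
      = Pspace n v k ∧
    Module.rank ℝ (Pspace n v k) = ((Bk n v y k).ncard : Cardinal) := by
  have hli := aux_li n v M y k hinc lam bp hgeneric
  have hsp : Submodule.span ℝ (Set.range fun B : Bk n v y k =>
      qProd n (Sum.elim v y) lam
        (XYup ι M (mVal n k (leftPart (B : Finset (ι ⊕ Fin M)))) \ (B : Finset (ι ⊕ Fin M))))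
      = Pspace n v k := by
    apply le_antisymm
    · rw [Submodule.span_le]
      rintro _ ⟨B, rfl⟩
      have hI := aux_leftIndep n v y B B.2.1
      have hmM := hM _ hI
      have hYc := aux_card_YFin hmM
      have hIn := aux_card_le n v _ hI
      have hBc := aux_basis_card n _ _ B.2.1
      have hp := aux_disjSum_parts (B : Finset (ι ⊕ Fin M))
      have hS : rightPart (B : Finset (ι ⊕ Fin M)) ⊆
          YFin (mVal n k (leftPart (B : Finset (ι ⊕ Fin M)))) := by
        intro b hb
        have := B.2.2 b (by simpa [rightPart] using hb)
        simpa [YFin] using this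
      have hq := aux_qProd n (mVal n k (leftPart (B : Finset (ι ⊕ Fin M)))) (Sum.elim v y) lam
        (leftPart (B : Finset (ι ⊕ Fin M))) (rightPart (B : Finset (ι ⊕ Fin M)))
      rw [hp] at hq
      simp only [SetLike.mem_coe]
      rw [hq]
      have hx : ∀ a, qL n (Sum.elim v y) lam (Sum.inl a) =
          pLin n (v a) + C (-lam (Sum.inl a)) := by
        intro a
        simp [qL, sub_eq_add_neg]
      simp only [hx]
      refine aux_expand n (fun a => pLin n (v a)) (fun a => -lam (Sum.inl a)) k
        (aux_mono n v k hsolid) _ ?_ _ _ ?_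
      · intro Z f hf
        refine Submodule.mem_iSup_of_mem Z ?_
        exact ⟨f, (mem_restrictTotalDegree _ _ _).2 hf, rfl⟩
      · refine (aux_totalDeg_qProd_inr n _ _ _).trans ?_
        rw [Finset.card_sdiff_of_subset hS, hYc]
        rw [← hp, Finset.card_disjSum] at hBc
        unfold mVal
        omega
    · refine iSup_le fun Z => ?_
      rintro _ ⟨f, hf, rfl⟩
      have hf' := (mem_restrictTotalDegree _ _ _).1 hf
      have hx : ∀ a, pLin n (v a) =
          qL n (Sum.elim v y) lam (Sum.inl a) + C (lam (Sum.inl a)) := by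
        intro a
        simp [qL]
      simp only [LinearMap.mulLeft_apply, pProd, hx]
      refine aux_expand n (fun a => qL n (Sum.elim v y) lam (Sum.inl a))
        (fun a => lam (Sum.inl a)) k (aux_mono n v k hsolid) _ ?_ Z f hf'
      intro Z f hf
      refine aux_span n v M y hspan hgen k hsolid hM hinc lam bp hgeneric _ ?_ Z f hf
      intro B hB
      exact Submodule.subset_span ⟨⟨B, hB⟩, rfl⟩
  refine ⟨hli, hsp, ?_⟩
  rw [← hsp, rank_span hli, Cardinal.mk_range_eq _ hli.injective]
  exact (Set.cast_ncard (Set.toFinite _)).symm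
end
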